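/- Let ν ∈ ℕ, ν ≥ 1, let P ∈ ℝ^ν, and let Ω, ω : ℝ^ν → ℝ be real-analytic functions such that F_P(k) = Ω(P−k) + ω(k) satisfies F_P(k) → ∞ as |k| → ∞. Then the threshold set θ(P) = {λ ∈ ℝ : there exists k ∈ ℝ^ν with λ = Ω(P−k) + ω(k) and ∇Ω(P−k) = ∇ω(k)} (the set of critical values of F_P) is a closed, locally finite subset of ℝ: its intersection with every compact interval is finite. In particular, θ(P) is at most countable and has Lebesgue measure zero. -/

import Mathlib

open Filter MeasureTheory

/-- The threshold set `θ(P)` of the fiber Hamiltonian `H(P)`: the set of critical values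
of `F_P(k) = Ω(P−k) + ω(k)`. -/
def thresholdSet (ν : ℕ) (Ω ω : EuclideanSpace ℝ (Fin ν) → ℝ)
    (P : EuclideanSpace ℝ (Fin ν)) : Set ℝ :=
  {lam : ℝ | ∃ k : EuclideanSpace ℝ (Fin ν),
    lam = Ω (P - k) + ω k ∧ gradient Ω (P - k) = gradient ω k}

open Topology

open scoped TensorProduct in
theorem exists_derivation_extension {R S T : Type*} [CommRing R] [CommRing S] [CommRing T]
    [Algebra R S] [Algebra R T] [Algebra S T] [IsScalarTower R S T] [Algebra.FormallyEtale S T]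
    (d : Derivation R S T) : ∃ D : Derivation R T T, ∀ s, D (algebraMap S T s) = d s := by
  refine ⟨((d.liftKaehlerDifferential.liftBaseChange T).comp
    (KaehlerDifferential.tensorKaehlerEquivOfFormallyEtale R S T).symm.toLinearMap).compDer
    (KaehlerDifferential.D R T), fun s => ?_⟩
  simp [KaehlerDifferential.tensorKaehlerEquivOfFormallyEtale_symm_D_algebraMap]

theorem isAlgebraic_of_coeff_minpoly {R F K : Type*} [Field R] [Field F] [Field K]
    [Algebra R F] [Algebra R K] [Algebra F K] [IsScalarTower R F K] {a : K} (ha : IsIntegral F a)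
    (h : ∀ k, IsAlgebraic R ((minpoly F a).coeff k)) : IsAlgebraic R a := by
  let L := algebraicClosure R F
  have : minpoly F a ∈ Polynomial.lifts (algebraMap L F) := by
    rw [Polynomial.lifts_iff_coeff_lifts]
    intro k
    exact ⟨⟨_, (mem_algebraicClosure_iff).2 (h k)⟩, rfl⟩
  obtain ⟨q, hq⟩ := (Polynomial.mem_lifts _).1 this
  have hL : IsAlgebraic L a := by
    refine ⟨q, ?_, ?_⟩
    · rintro rfl
      exact minpoly.ne_zero ha (by simpa using hq.symm)
    · rw [← Polynomial.aeval_map_algebraMap F, hq, minpoly.aeval]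
  exact hL.restrictScalars R

theorem derivation_coeff_minpoly_eq_zero {R F K : Type*} [CommRing R] [Field F] [Field K]
    [Algebra R F] [Algebra R K] [Algebra F K] [IsScalarTower R F K]
    (d : Derivation R F F) (D : Derivation R K K)
    (hD : ∀ s, D (algebraMap F K s) = algebraMap F K (d s)) {a : K} (ha : IsIntegral F a)
    (hDa : D a = 0) (k : ℕ) : d ((minpoly F a).coeff k) = 0 := by
  set p := minpoly F a with hp
  let q : Polynomial F := ∑ i ∈ Finset.range p.natDegree, Polynomial.monomial i (d (p.coeff i))
  have hpow (i : ℕ) : D (a ^ i) = 0 := by simp [D.leibniz_pow, hDa]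
  have hq : Polynomial.aeval a q = 0 := by
    have h0 : D (Polynomial.aeval a p) = 0 := by rw [hp, minpoly.aeval, map_zero]
    rw [Polynomial.aeval_eq_sum_range, map_sum, Finset.sum_range_succ,
      (minpoly.monic ha).coeff_natDegree, one_smul, hpow, add_zero] at h0
    rw [← h0, map_sum]
    refine Finset.sum_congr rfl fun i _ => ?_
    rw [Polynomial.aeval_monomial, Algebra.smul_def, D.leibniz, hpow, hD]
    simp [mul_comm]
  have hq0 : q = 0 := by
    by_contra hne
    have h1 := minpoly.degree_le_of_ne_zero F a hne hq
    have h2 : q.degree < p.natDegree := by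
      refine (Polynomial.degree_sum_le _ _).trans_lt ?_
      rw [Finset.sup_lt_iff (WithBot.bot_lt_coe _)]
      intro i hi
      exact (Polynomial.degree_monomial_le _ _).trans_lt
        (WithBot.coe_lt_coe.2 (Finset.mem_range.1 hi))
    rw [Polynomial.degree_eq_natDegree (minpoly.ne_zero ha)] at h1
    exact absurd (h2.trans_le h1) (lt_irrefl _)
  rcases lt_trichotomy k p.natDegree with h | h | h
  · have := congrArg (Polynomial.coeff · k) hq0
    simpa [q, Polynomial.finsetSum_coeff, Polynomial.coeff_monomial, h] using this
  · rw [h, (minpoly.monic ha).coeff_natDegree, d.map_one_eq_zero]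
  · rw [Polynomial.coeff_eq_zero_of_natDegree_lt h, map_zero]

/-- The algebra of functions on `ℝⁿ` that are analytic at the origin. -/
def analyticAtZero (n : ℕ) : Subalgebra ℝ ((Fin n → ℝ) → ℝ) where
  carrier := {f | AnalyticAt ℝ f 0}
  mul_mem' := fun hf hg => AnalyticAt.mul hf hg
  add_mem' := fun hf hg => AnalyticAt.add hf hg
  algebraMap_mem' := fun _ => analyticAt_const

namespace analyticAtZero

variable {m n : ℕ}

/-- The partial derivative of a function analytic at the origin. -/
noncomputable def pderiv (i : Fin n) (f : analyticAtZero n) : analyticAtZero n :=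
  ⟨fun x => fderiv ℝ f.1 x (Pi.single i 1),
    (ContinuousLinearMap.apply ℝ ℝ (Pi.single i (1 : ℝ) : Fin n → ℝ)).analyticAt _ |>.comp
      (AnalyticAt.fderiv f.2)⟩

/-- The coordinate functions. -/
def coord (i : Fin n) : analyticAtZero n :=
  ⟨fun x => x i, (ContinuousLinearMap.proj (R := ℝ) (φ := fun _ : Fin n => ℝ) i).analyticAt 0⟩

/-- Precomposition with a linear map. -/
def pullback (L : (Fin m → ℝ) →L[ℝ] (Fin n → ℝ)) : analyticAtZero n →ₐ[ℝ] analyticAtZero m where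
  toFun f := ⟨fun x => f.1 (L x),
    AnalyticAt.fun_comp (by rw [map_zero]; exact f.2) (L.analyticAt 0)⟩
  map_one' := rfl
  map_mul' _ _ := rfl
  map_zero' := rfl
  map_add' _ _ := rfl
  commutes' _ := rfl

@[simp]
theorem pullback_apply (L : (Fin m → ℝ) →L[ℝ] (Fin n → ℝ)) (f : analyticAtZero n) (x) :
    (pullback L f).1 x = f.1 (L x) := rfl

theorem eventually_differentiableAt (f : analyticAtZero n) :
    ∀ᶠ x in 𝓝 0, DifferentiableAt ℝ f.1 x :=
  (AnalyticAt.eventually_analyticAt f.2).mono fun _ h => h.differentiableAt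

theorem pderiv_add (i : Fin n) (f g : analyticAtZero n) :
    (pderiv i (f + g)).1 =ᶠ[𝓝 0] (pderiv i f + pderiv i g).1 := by
  filter_upwards [eventually_differentiableAt f, eventually_differentiableAt g] with x hf hg
  change fderiv ℝ (f.1 + g.1) x _ = fderiv ℝ f.1 x _ + fderiv ℝ g.1 x _
  rw [fderiv_add hf hg]; rfl

theorem pderiv_mul (i : Fin n) (f g : analyticAtZero n) :
    (pderiv i (f * g)).1 =ᶠ[𝓝 0] (f * pderiv i g + g * pderiv i f).1 := by
  filter_upwards [eventually_differentiableAt f, eventually_differentiableAt g] with x hf hg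
  change fderiv ℝ (f.1 * g.1) x _ = f.1 x * fderiv ℝ g.1 x _ + g.1 x * fderiv ℝ f.1 x _
  rw [fderiv_mul hf hg]; rfl

theorem pderiv_algebraMap (i : Fin n) (c : ℝ) :
    pderiv i (algebraMap ℝ (analyticAtZero n) c) = 0 := by
  ext x
  change fderiv ℝ (fun _ => c) x _ = 0
  simp

theorem pderiv_coord (i j : Fin n) :
    pderiv i (coord j) = algebraMap ℝ _ ((Pi.single i 1 : Fin n → ℝ) j) := by
  ext x
  change fderiv ℝ (ContinuousLinearMap.proj (R := ℝ) (φ := fun _ : Fin n => ℝ) j) x _ = _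
  rw [ContinuousLinearMap.fderiv]
  rfl

theorem pderiv_congr (i : Fin n) {f g : analyticAtZero n} (h : f.1 =ᶠ[𝓝 0] g.1) :
    (pderiv i f).1 =ᶠ[𝓝 0] (pderiv i g).1 := by
  filter_upwards [h.fderiv (𝕜 := ℝ)] with x hx
  change fderiv ℝ f.1 x _ = fderiv ℝ g.1 x _
  rw [hx]

theorem pderiv_pullback (L : (Fin m → ℝ) →L[ℝ] (Fin n → ℝ)) (i : Fin m) (f : analyticAtZero n) :
    (pderiv i (pullback L f)).1 =ᶠ[𝓝 0]
      (∑ j, L (Pi.single i 1) j • pullback L (pderiv j f)).1 := by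
  have hL : Tendsto L (𝓝 0) (𝓝 0) := by simpa using L.continuous.tendsto 0
  filter_upwards [hL.eventually (eventually_differentiableAt f)] with x hf
  have h1 : fderiv ℝ (fun x => f.1 (L x)) x = (fderiv ℝ f.1 (L x)).comp L :=
    (hf.hasFDerivAt.comp x L.hasFDerivAt).fderiv
  change fderiv ℝ (fun x => f.1 (L x)) x _ = _
  rw [h1, ContinuousLinearMap.comp_apply]
  conv_lhs => rw [pi_eq_sum_univ' (L (Pi.single i 1)), map_sum]
  simp only [map_smul]
  simp [pderiv, Finset.sum_apply]

end analyticAtZero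

section Lift

variable {N : ℕ} {X : Type*} [NormedAddCommGroup X] [NormedSpace ℝ X]

theorem comp_prod_ofFn {A : Fin N → X →L[ℝ] X} {a : Fin N → ℝ} {φ : X →L[ℝ] ℝ}
    (h : ∀ i, φ.comp (A i) = a i • φ) : ∀ {m : ℕ} (i : Fin m → Fin N),
    φ.comp (List.ofFn fun j => A (i j)).prod = (∏ j, a (i j)) • φ
  | 0, i => by ext; simp
  | m + 1, i => by
    rw [List.ofFn_succ, List.prod_cons, ContinuousLinearMap.mul_def,
      ← ContinuousLinearMap.comp_assoc, h, ContinuousLinearMap.smul_comp, comp_prod_ofFn h,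
      smul_smul, Fin.prod_univ_succ]

variable (X) in
/-- The substitution of operators for the variables of a power series. -/
noncomputable def operatorSeries (p : FormalMultilinearSeries ℝ (Fin N → ℝ) ℝ) :
    FormalMultilinearSeries ℝ (Fin N → X →L[ℝ] X) (X →L[ℝ] X) := fun m =>
  ∑ i : Fin m → Fin N, p m (fun j => Pi.single (i j) 1) •
    (ContinuousMultilinearMap.mkPiAlgebraFin ℝ m (X →L[ℝ] X)).compContinuousLinearMap
      fun j => ContinuousLinearMap.proj (R := ℝ) (i j)

theorem comp_operatorSeries (p : FormalMultilinearSeries ℝ (Fin N → ℝ) ℝ)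
    {A : Fin N → X →L[ℝ] X} {a : Fin N → ℝ} {φ : X →L[ℝ] ℝ}
    (h : ∀ i, φ.comp (A i) = a i • φ) (m : ℕ) :
    φ.comp (operatorSeries X p m fun _ => A) = (p m fun _ => a) • φ := by
  have hp : (p m fun _ => a) = ∑ i : Fin m → Fin N, (∏ j, a (i j)) *
      p m (fun j => Pi.single (i j) 1) := by
    have ha : a = ∑ i, a i • (Pi.single i 1 : Fin N → ℝ) := by
      ext j
      simp [Finset.sum_apply, Pi.single_apply]
    conv_lhs => rw [ha]
    rw [ContinuousMultilinearMap.map_sum]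
    refine Finset.sum_congr rfl fun i _ => ?_
    rw [ContinuousMultilinearMap.map_smul_univ, smul_eq_mul]
  rw [hp, Finset.sum_smul]
  ext x
  simp only [operatorSeries, ContinuousLinearMap.comp_apply, sum_apply, map_sum, smul_apply,
    map_smul,
    ContinuousMultilinearMap.compContinuousLinearMap_apply,
    ContinuousMultilinearMap.mkPiAlgebraFin_apply, ContinuousLinearMap.proj_apply]
  refine Finset.sum_congr rfl fun i _ => ?_
  have := congrArg (fun ψ : X →L[ℝ] ℝ => ψ x) (comp_prod_ofFn h i)
  simp only [ContinuousLinearMap.comp_apply, smul_apply] at this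
  rw [this, smul_smul, mul_comm]

theorem norm_operatorSeries_le (p : FormalMultilinearSeries ℝ (Fin N → ℝ) ℝ) (m : ℕ) :
    ‖operatorSeries X p m‖ ≤ N ^ m * (‖p m‖ * max 1 ‖(1 : X →L[ℝ] X)‖) := by
  refine ContinuousMultilinearMap.opNorm_le_bound (by positivity) fun v => ?_
  have hterm (i : Fin m → Fin N) : ‖(p m fun j => Pi.single (i j) 1) •
      ContinuousMultilinearMap.mkPiAlgebraFin ℝ m (X →L[ℝ] X) fun j => v j (i j)‖ ≤
      ‖p m‖ * max 1 ‖(1 : X →L[ℝ] X)‖ * ∏ j, ‖v j‖ := by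
    rw [norm_smul, mul_assoc]
    have h1 : ‖p m fun j => Pi.single (i j) 1‖ ≤ ‖p m‖ := by
      simpa [Pi.norm_single] using (p m).le_opNorm fun j => Pi.single (i j) 1
    refine mul_le_mul h1 ?_ (norm_nonneg _) (norm_nonneg _)
    refine (ContinuousMultilinearMap.le_opNorm _ _).trans ?_
    gcongr with j
    · exact ContinuousMultilinearMap.norm_mkPiAlgebraFin_le
    · exact norm_le_pi_norm (v j) (i j)
  have hsum : operatorSeries X p m v = ∑ i : Fin m → Fin N, (p m fun j => Pi.single (i j) 1) •
      ContinuousMultilinearMap.mkPiAlgebraFin ℝ m (X →L[ℝ] X) fun j => v j (i j) := by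
    simp [operatorSeries]
  rw [hsum]
  refine (norm_sum_le_of_le Finset.univ fun i _ => hterm i).trans_eq ?_
  simp [mul_assoc]

theorem radius_operatorSeries_pos {p : FormalMultilinearSeries ℝ (Fin N → ℝ) ℝ}
    (hp : 0 < p.radius) : 0 < (operatorSeries X p).radius := by
  obtain ⟨C, r, hC, hr, hbound⟩ := p.le_mul_pow_of_radius_pos hp
  let s : NNReal := ⟨(r * (N + 1))⁻¹, by positivity⟩
  have hs : 0 < s := by
    change (0 : ℝ) < (r * (N + 1))⁻¹
    positivity
  refine (ENNReal.coe_pos.2 hs).trans_le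
    ((operatorSeries X p).le_radius_of_bound (C * max 1 ‖(1 : X →L[ℝ] X)‖) fun m => ?_)
  have hs' : (s : ℝ) = (r * (N + 1))⁻¹ := rfl
  rw [hs', inv_pow, mul_pow, ← div_eq_mul_inv, div_le_iff₀ (by positivity)]
  calc ‖operatorSeries X p m‖ ≤ N ^ m * (‖p m‖ * max 1 ‖(1 : X →L[ℝ] X)‖) :=
        norm_operatorSeries_le p m
    _ ≤ (N + 1) ^ m * ((C * r ^ m) * max 1 ‖(1 : X →L[ℝ] X)‖) := by
        gcongr
        · linarith
        · exact hbound m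
    _ = _ := by ring

/-- An analytic function of several variables extends to an analytic function of operators,
compatibly with common left eigenvectors. -/
theorem AnalyticAt.exists_operator_lift [CompleteSpace X] {f : (Fin N → ℝ) → ℝ}
    (hf : AnalyticAt ℝ f 0) :
    ∃ F : (Fin N → X →L[ℝ] X) → X →L[ℝ] X, AnalyticAt ℝ F 0 ∧
      ∀ᶠ Aa : (Fin N → X →L[ℝ] X) × (Fin N → ℝ) in 𝓝 0, ∀ φ : X →L[ℝ] ℝ,
        (∀ i, φ.comp (Aa.1 i) = Aa.2 i • φ) → φ.comp (F Aa.1) = f Aa.2 • φ := by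
  obtain ⟨p, r, hp⟩ := hf
  have hpos := radius_operatorSeries_pos (X := X) (hp.r_pos.trans_le hp.r_le)
  have hF := (operatorSeries X p).hasFPowerSeriesOnBall hpos
  refine ⟨_, hF.analyticAt, ?_⟩
  rw [Prod.zero_eq_mk, nhds_prod_eq]
  filter_upwards [prod_mem_prod (Metric.eball_mem_nhds 0 hF.r_pos)
    (Metric.eball_mem_nhds 0 hp.r_pos)]
    with Aa hAa φ hφ
  have h1 := hF.hasSum hAa.1
  have h2 := hp.hasSum hAa.2
  rw [zero_add] at h1 h2
  have h3 := h1.mapL (ContinuousLinearMap.compL ℝ X X ℝ φ)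
  have h4 := h2.smul_const φ
  refine h3.unique ?_
  simpa only [ContinuousLinearMap.compL_apply, comp_operatorSeries p hφ] using h4

end Lift

section Shift

/-- A Banach space with a forward shift `S`, a backward shift `B`, a first basis vector `e` and a
first coordinate functional `φ`, whose elements are determined by their coordinates. -/
structure IsShift {X : Type*} [NormedAddCommGroup X] [NormedSpace ℝ X] (S B : X →L[ℝ] X) (e : X)
    (φ : X →L[ℝ] ℝ) : Prop where
  backward_mul_forward : B * S = 1
  forward_mul_backward : S * B = 1 - φ.smulRight e
  apply_basis : φ e = 1
  ext_coordinates : ∀ x, (∀ k : ℕ, φ ((B ^ k) x) = 0) → x = 0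

open BoundedContinuousFunction in
theorem exists_isShift : ∃ (X : Type) (_ : NormedAddCommGroup X) (_ : NormedSpace ℝ X)
    (_ : CompleteSpace X) (S B : X →L[ℝ] X) (e : X) (φ : X →L[ℝ] ℝ), IsShift S B e φ := by
  let cons (a : ℝ) (f : ℕ →ᵇ ℝ) : ℕ →ᵇ ℝ := ofNormedAddCommGroupDiscrete
    (fun n => Nat.casesOn n a f) (max |a| ‖f‖) fun n => by
      cases n with
      | zero => exact le_max_left _ _
      | succ n => exact (f.norm_coe_le_norm n).trans (le_max_right _ _)
  have cons_zero (a f) : cons a f 0 = a := rfl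
  have cons_succ (a f n) : cons a f (n + 1) = f n := rfl
  let S : (ℕ →ᵇ ℝ) →L[ℝ] (ℕ →ᵇ ℝ) := LinearMap.mkContinuous
    { toFun := cons 0
      map_add' := fun f g => by ext n; cases n <;> simp [cons_zero, cons_succ]
      map_smul' := fun c f => by ext n; cases n <;> simp [cons_zero, cons_succ] } 1 fun f => by
        rw [one_mul]
        refine (BoundedContinuousFunction.norm_le (norm_nonneg f)).2 fun n => ?_
        cases n with
        | zero => simp [cons_zero]
        | succ n => exact f.norm_coe_le_norm n
  let B : (ℕ →ᵇ ℝ) →L[ℝ] (ℕ →ᵇ ℝ) := LinearMap.mkContinuous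
    { toFun := fun f => f.compContinuous ⟨Nat.succ, continuous_of_discreteTopology⟩
      map_add' := fun f g => rfl
      map_smul' := fun c f => rfl } 1 fun f => by
        rw [one_mul]
        exact (BoundedContinuousFunction.norm_le (norm_nonneg f)).2 fun n =>
          f.norm_coe_le_norm (n + 1)
  have hS0 (f) : S f 0 = 0 := rfl
  have hS (f n) : S f (n + 1) = f n := rfl
  have hB (f n) : B f n = f (n + 1) := rfl
  refine ⟨ℕ →ᵇ ℝ, inferInstance, inferInstance, inferInstance, S, B, cons 1 0,
    BoundedContinuousFunction.evalCLM ℝ 0, ?_, ?_, ?_, fun x hx => ?_⟩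
  · ext f n
    simp [hB, hS]
  · ext f n
    cases n <;> simp [hB, hS, hS0, cons_zero, cons_succ]
  · simp [cons_zero]
  · have hBk (k : ℕ) : ∀ f n, (B ^ k) f n = f (n + k) := by
      induction k with
      | zero => simp
      | succ k ih =>
        intro f n
        rw [pow_succ, mul_apply_eq_comp, ih, hB, add_assoc]
    ext k
    have h := hx k
    rwa [evalCLM_apply, hBk, zero_add] at h

namespace IsShift

variable {X : Type*} [NormedAddCommGroup X] [NormedSpace ℝ X] {S B : X →L[ℝ] X} {e : X}
  {φ : X →L[ℝ] ℝ}

theorem comp_forward (h : IsShift S B e φ) : φ.comp S = 0 := by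
  have h1 : S * B * S = S := by rw [mul_assoc, h.backward_mul_forward, mul_one]
  ext x
  have h2 := congrArg (fun T : X →L[ℝ] X => φ (T x)) h1
  simpa [h.forward_mul_backward, h.apply_basis, sub_mul] using h2.symm

theorem backward_basis (h : IsShift S B e φ) : B e = 0 := by
  have h1 : S (B e) = 0 := by
    have := congrArg (fun T : X →L[ℝ] X => T e) h.forward_mul_backward
    simpa [h.apply_basis] using this
  have h2 := congrArg (fun T : X →L[ℝ] X => T (B e)) h.backward_mul_forward
  simpa [h1] using h2.symm

/-- Evaluation at `t` of the generating function of the coordinates. -/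
noncomputable def eval (B : X →L[ℝ] X) (φ : X →L[ℝ] ℝ) (t : ℝ) : X →L[ℝ] ℝ :=
  φ.comp (Ring.inverse (1 - t • B))

theorem eventually_isUnit [CompleteSpace X] (B : X →L[ℝ] X) :
    ∀ᶠ t : ℝ in 𝓝 0, IsUnit (1 - t • B) := by
  have hc : Continuous fun t : ℝ => 1 - t • B := by fun_prop
  exact hc.tendsto' 0 1 (by simp) (Units.isOpen.mem_nhds isUnit_one)

section Eval

variable {t : ℝ}

theorem eval_comp_forward (h : IsShift S B e φ) (ht : IsUnit (1 - t • B)) :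
    (eval B φ t).comp S = t • eval B φ t := by
  have h1 : S = Ring.inverse (1 - t • B) * (S - t • 1) := by
    have : S - t • 1 = (1 - t • B) * S := by
      rw [sub_mul, one_mul, smul_mul_assoc, h.backward_mul_forward]
    rw [this, Ring.inverse_mul_cancel_left _ _ ht]
  ext x
  have h2 := congrArg (fun T : X →L[ℝ] X => φ (T x)) h1
  have h3 := congrArg (fun T : X →L[ℝ] ℝ => T x) h.comp_forward
  simp only [ContinuousLinearMap.comp_apply, zero_apply] at h3
  simp only [h3, mul_apply_eq_comp, sub_apply, smul_apply, map_sub, map_smul,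
    one_apply_eq_self] at h2
  simp only [eval, ContinuousLinearMap.comp_apply, smul_apply]
  linarith

theorem eval_basis (h : IsShift S B e φ) (ht : IsUnit (1 - t • B)) :
    eval B φ t e = 1 := by
  have h1 : (1 - t • B) e = e := by simp [h.backward_basis]
  have h2 := congrArg (fun T : X →L[ℝ] X => T e) (Ring.inverse_mul_cancel _ ht)
  simp only [mul_apply_eq_comp, h1, one_apply_eq_self] at h2
  rw [eval, ContinuousLinearMap.comp_apply, h2, h.apply_basis]

theorem eval_apply (h : IsShift S B e φ) (ht : IsUnit (1 - t • B))
    (x : X) : eval B φ t x = φ x + t * eval B φ t (B x) := by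
  have h1 : x = S (B x) + φ x • e := by
    have := congrArg (fun T : X →L[ℝ] X => T x) h.forward_mul_backward
    simp only [mul_apply_eq_comp, sub_apply, one_apply_eq_self,
      ContinuousLinearMap.smulRight_apply] at this
    rw [this, sub_add_cancel]
  have h2 := congrArg (fun T : X →L[ℝ] ℝ => T (B x)) (h.eval_comp_forward ht)
  simp only [ContinuousLinearMap.comp_apply, smul_apply, smul_eq_mul] at h2
  conv_lhs => rw [h1]
  rw [map_add, h2, map_smul, h.eval_basis ht, smul_eq_mul, mul_one, add_comm]

theorem eval_pow_comp_forward (h : IsShift S B e φ) (ht : IsUnit (1 - t • B))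
    (d : ℕ) (x : X) :
    eval B φ t ((S ^ d) x) = t ^ d * eval B φ t x := by
  induction d with
  | zero => simp
  | succ d ih =>
    have h2 := congrArg (fun T : X →L[ℝ] ℝ => T ((S ^ d) x)) (h.eval_comp_forward ht)
    simp only [ContinuousLinearMap.comp_apply, smul_apply, smul_eq_mul] at h2
    rw [pow_succ', mul_apply_eq_comp, h2, ih, pow_succ', mul_assoc]

theorem eval_eq_sum_add (h : IsShift S B e φ) (ht : IsUnit (1 - t • B))
    (d : ℕ) (x : X) :
    eval B φ t x =
        ∑ k : Fin d, t ^ (k : ℕ) * φ ((B ^ (k : ℕ)) x) + t ^ d * eval B φ t ((B ^ d) x) := by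
  induction d with
  | zero => simp
  | succ d ih =>
    rw [ih, h.eval_apply ht ((B ^ d) x), Fin.sum_univ_castSucc, pow_succ', pow_succ',
      mul_apply_eq_comp]
    simp only [Fin.val_castSucc, Fin.val_last]
    ring

end Eval

theorem analyticAt_eval [CompleteSpace X] (B : X →L[ℝ] X) (φ : X →L[ℝ] ℝ) :
    AnalyticAt ℝ (eval B φ) 0 := by
  have h1 : AnalyticAt ℝ (fun t : ℝ => Ring.inverse (1 - t • B)) 0 := by
    refine AnalyticAt.fun_comp ?_ (analyticAt_const.sub (analyticAt_id.smul analyticAt_const))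
    simpa using analyticAt_inverse (𝕜 := ℝ) (1 : (X →L[ℝ] X)ˣ)
  exact ((ContinuousLinearMap.compL ℝ X X ℝ φ).analyticAt _).fun_comp h1

theorem eq_zero_of_eventually_eval [CompleteSpace X] (h : IsShift S B e φ) {x : X}
    (hx : ∀ᶠ t in 𝓝 (0 : ℝ), eval B φ t x = 0) : x = 0 := by
  have hcont (y : X) : ContinuousAt (fun t => eval B φ t y) 0 :=
    (analyticAt_eval B φ).continuousAt.clm_apply continuousAt_const
  have key (y : X) (hy : ∀ᶠ t in 𝓝[≠] (0 : ℝ), eval B φ t y = 0) :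
      φ y = 0 ∧ ∀ᶠ t in 𝓝[≠] (0 : ℝ), eval B φ t (B y) = 0 := by
    have h0 : φ y = 0 := by
      have : eval B φ 0 y = 0 := tendsto_nhds_unique
        ((hcont y).tendsto.mono_left nhdsWithin_le_nhds)
        (tendsto_const_nhds.congr' (hy.mono fun t ht => ht.symm))
      simpa [eval] using this
    refine ⟨h0, ?_⟩
    filter_upwards [hy, (eventually_isUnit B).filter_mono nhdsWithin_le_nhds,
      self_mem_nhdsWithin] with t ht hu ht0
    rw [h.eval_apply hu, h0, zero_add] at ht
    exact (mul_eq_zero.1 ht).resolve_left ht0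
  refine h.ext_coordinates x fun k => (key _ ?_).1
  induction k with
  | zero => simpa using hx.filter_mono nhdsWithin_le_nhds
  | succ k ih =>
    rw [pow_succ']
    exact (key _ ih).2

end IsShift

end Shift

section Division

variable {n : ℕ} {X : Type*} [NormedAddCommGroup X] [NormedSpace ℝ X]

/-- The operators substituted for the variables: a multiple of `S` for the first one and scalars
for the others. -/
noncomputable def operatorPoint (T : X →L[ℝ] X) (y : Fin n → ℝ) : Fin (n + 1) → X →L[ℝ] X :=
  Fin.cons T fun i => y i • 1

theorem analyticAt_operatorPoint (T : X →L[ℝ] X) (y : Fin n → ℝ) :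
    AnalyticAt ℝ (operatorPoint T) y := by
  refine AnalyticAt.pi fun i => ?_
  induction i using Fin.cases with
  | zero => exact analyticAt_const
  | succ i =>
    exact ((ContinuousLinearMap.proj (R := ℝ) (φ := fun _ : Fin n => ℝ) i).analyticAt y).smul
      analyticAt_const

theorem tendsto_operatorPoint (S : X →L[ℝ] X) :
    Tendsto (fun ρ : ℝ => operatorPoint (ρ • S) (0 : Fin n → ℝ)) (𝓝 0) (𝓝 0) := by
  rw [tendsto_pi_nhds]
  intro i
  induction i using Fin.cases with
  | zero =>
    have : Continuous fun ρ : ℝ => ρ • S := by fun_prop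
    exact this.tendsto' 0 _ (by simp)
  | succ i => simp [operatorPoint]

theorem comp_operatorPoint {T : X →L[ℝ] X} {z : Fin (n + 1) → ℝ} {φ : X →L[ℝ] ℝ}
    (h : φ.comp T = z 0 • φ) (i : Fin (n + 1)) :
    φ.comp (operatorPoint T (fun i => z i.succ) i) = z i • φ := by
  induction i using Fin.cases with
  | zero => exact h
  | succ i =>
    ext x
    simp [operatorPoint]

variable {S B : X →L[ℝ] X} {e : X} {φ : X →L[ℝ] ℝ}

/-- The lift of an analytic function to operators, evaluated at a small multiple of the shift. -/
theorem IsShift.eventually_eval_lift [CompleteSpace X] (h : IsShift S B e φ)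
    {f : (Fin (n + 1) → ℝ) → ℝ} {F : (Fin (n + 1) → X →L[ℝ] X) → X →L[ℝ] X}
    (hF : ∀ᶠ Aa : (Fin (n + 1) → X →L[ℝ] X) × (Fin (n + 1) → ℝ) in 𝓝 0, ∀ φ : X →L[ℝ] ℝ,
      (∀ i, φ.comp (Aa.1 i) = Aa.2 i • φ) → φ.comp (F Aa.1) = f Aa.2 • φ) :
    ∀ᶠ ρ in 𝓝[≠] (0 : ℝ), ∀ᶠ z in 𝓝 (0 : Fin (n + 1) → ℝ), ∀ x,
      IsShift.eval B φ (z 0 / ρ) (F (operatorPoint (ρ • S) fun i => z i.succ) x) =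
        f z * IsShift.eval B φ (z 0 / ρ) x := by
  have h1 : Tendsto (fun ρ : ℝ => (operatorPoint (ρ • S) (0 : Fin n → ℝ),
      (0 : Fin (n + 1) → ℝ))) (𝓝[≠] 0) (𝓝 0) :=
    ((tendsto_operatorPoint S).mono_left nhdsWithin_le_nhds).prodMk_nhds tendsto_const_nhds
  filter_upwards [h1.eventually hF.eventually_nhds, self_mem_nhdsWithin] with ρ hρ hρ0
  have h2 : Tendsto (fun z : Fin (n + 1) → ℝ =>
      (operatorPoint (ρ • S) fun i => z i.succ, z)) (𝓝 0)
      (𝓝 (operatorPoint (ρ • S) (0 : Fin n → ℝ), (0 : Fin (n + 1) → ℝ))) := by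
    refine Tendsto.prodMk_nhds ?_ tendsto_id
    refine (analyticAt_operatorPoint (ρ • S) 0).continuousAt.tendsto.comp ?_
    exact Continuous.tendsto' (by fun_prop) _ _ rfl
  have h3 : Tendsto (fun z : Fin (n + 1) → ℝ => z 0 / ρ) (𝓝 0) (𝓝 0) :=
    Continuous.tendsto' (by fun_prop) _ _ (by simp)
  filter_upwards [h2.eventually hρ, h3.eventually (IsShift.eventually_isUnit B)] with z hz hu x
  have h4 := hz (IsShift.eval B φ (z 0 / ρ)) (comp_operatorPoint (by
    rw [ContinuousLinearMap.comp_smul, h.eval_comp_forward hu, smul_smul,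
      mul_div_cancel₀ _ hρ0]))
  exact congrArg (fun ψ : X →L[ℝ] ℝ => ψ x) h4

end Division

theorem exists_weierstrass_division {n : ℕ} {g : (Fin (n + 1) → ℝ) → ℝ} (hg : AnalyticAt ℝ g 0)
    (hg0 : ¬ ∀ᶠ t in 𝓝 (0 : ℝ), g (Pi.single 0 t) = 0) :
    ∃ d : ℕ, ∀ h : (Fin (n + 1) → ℝ) → ℝ, AnalyticAt ℝ h 0 →
      ∃ (q : (Fin (n + 1) → ℝ) → ℝ) (r : Fin d → (Fin n → ℝ) → ℝ), AnalyticAt ℝ q 0 ∧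
        (∀ k, AnalyticAt ℝ (r k) 0) ∧
        ∀ᶠ z in 𝓝 0, h z = g z * q z + ∑ k, r k (fun i => z i.succ) * z 0 ^ (k : ℕ) := by
  have hline : AnalyticAt ℝ (fun t : ℝ => g (Pi.single 0 t)) 0 := by
    have hs : AnalyticAt ℝ (fun t : ℝ => (Pi.single 0 t : Fin (n + 1) → ℝ)) 0 :=
      (ContinuousLinearMap.single ℝ (fun _ : Fin (n + 1) => ℝ) 0).analyticAt 0
    exact AnalyticAt.fun_comp (by simpa using hg) hs
  obtain ⟨d, u, hu, hu0, hgu⟩ := hline.exists_eventuallyEq_pow_smul_nonzero_iff.2 hg0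
  refine ⟨d, fun h hh => ?_⟩
  obtain ⟨X, _, _, _, S, B, e, φ, hX⟩ := exists_isShift
  have hu' : AnalyticAt ℝ (fun z : Fin (n + 1) → ℝ => u (z 0)) 0 :=
    AnalyticAt.fun_comp (by simpa using hu)
      ((ContinuousLinearMap.proj (R := ℝ) (φ := fun _ : Fin (n + 1) => ℝ) 0).analyticAt 0)
  obtain ⟨G, hGan, hG⟩ := hg.exists_operator_lift (X := X)
  obtain ⟨H, hHan, hH⟩ := hh.exists_operator_lift (X := X)
  obtain ⟨U, hUan, hU⟩ := hu'.exists_operator_lift (X := X)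
  have hU0 : IsUnit (U 0) := by
    have h1 : U 0 = u 0 • 1 := by
      rw [← sub_eq_zero]
      ext x
      refine hX.eq_zero_of_eventually_eval (.of_forall fun t => ?_)
      have h2 := hU.self_of_nhds (IsShift.eval B φ t) fun i => by simp
      have h3 := congrArg (fun ψ : X →L[ℝ] ℝ => ψ x) h2
      simp only [Prod.fst_zero, Prod.snd_zero, Pi.zero_apply, ContinuousLinearMap.comp_apply,
        smul_apply] at h3
      simp [h3]
    rw [h1]
    rw [← Algebra.algebraMap_eq_smul_one]
    exact (IsUnit.mk0 _ hu0).map (algebraMap ℝ (X →L[ℝ] X))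
  have hpt := (tendsto_operatorPoint (n := n) S).mono_left
    (nhdsWithin_le_nhds (s := {0}ᶜ))
  obtain ⟨ρ, hρ0, hρG, hρH, hρU, hGρ, hHρ, hUρ⟩ := (
    (eventually_mem_nhdsWithin (a := (0 : ℝ)) (s := {0}ᶜ)).and <|
    (hX.eventually_eval_lift hG).and <| (hX.eventually_eval_lift hH).and <|
    (hX.eventually_eval_lift
      (f := fun z : Fin (n + 1) → ℝ => u (z 0)) hU).and <|
    (hpt.eventually hGan.eventually_analyticAt).and <|
    (hpt.eventually hHan.eventually_analyticAt).and <|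
    hpt.eventually (hUan.continuousAt.eventually (Units.isOpen.mem_nhds hU0))).exists
  replace hρ0 : ρ ≠ 0 := hρ0
  set V := U (operatorPoint (ρ • S) (0 : Fin n → ℝ)) with hV
  have hG0 : G (operatorPoint (ρ • S) (0 : Fin n → ℝ)) = (ρ • S) ^ d * V := by
    rw [← sub_eq_zero]
    ext x
    refine hX.eq_zero_of_eventually_eval ?_
    have hz : Tendsto (fun t : ℝ => (Pi.single 0 (ρ * t) : Fin (n + 1) → ℝ)) (𝓝 0) (𝓝 0) := by
      have : Continuous fun t : ℝ => (Pi.single 0 (ρ * t) : Fin (n + 1) → ℝ) :=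
        (continuous_single 0).comp (continuous_const.mul continuous_id)
      exact this.tendsto' 0 _ (by simp)
    have hρt : Tendsto (fun t : ℝ => ρ * t) (𝓝 0) (𝓝 0) :=
      Continuous.tendsto' (by fun_prop) _ _ (by simp)
    filter_upwards [hz.eventually hρG, hz.eventually hρU, hρt.eventually hgu,
      IsShift.eventually_isUnit B] with t h1 h2 h3 ht
    have htail : (fun i : Fin n => (Pi.single 0 (ρ * t) : Fin (n + 1) → ℝ) i.succ) = 0 := by
      ext i
      simp
    simp only [htail, Pi.single_eq_same, mul_div_cancel_left₀ _ hρ0, ← hV] at h1 h2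
    rw [sub_apply, map_sub, h1, h3, smul_eq_mul, smul_pow, smul_mul_assoc, smul_apply, map_smul,
      mul_apply_eq_comp, hX.eval_pow_comp_forward ht, h2, sub_zero, smul_eq_mul, mul_pow]
    ring
  let Q : X →L[ℝ] X := Ring.inverse V * (ρ⁻¹ • B) ^ d
  have hSB : (ρ • S) ^ d * (ρ⁻¹ • B) ^ d = S ^ d * B ^ d := by
    rw [smul_pow, smul_pow, smul_mul_smul_comm, ← mul_pow, mul_inv_cancel₀ hρ0, one_pow, one_smul]
  let W (y : Fin n → ℝ) : X →L[ℝ] X := G (operatorPoint (ρ • S) y) * Q + (1 - S ^ d * B ^ d)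
  have hW0 : W 0 = 1 := by
    simp only [W, Q, hG0]
    rw [mul_assoc, Ring.mul_inverse_cancel_left _ _ hUρ, hSB, add_sub_cancel]
  have hop := analyticAt_operatorPoint (n := n) (ρ • S) 0
  have hWan : AnalyticAt ℝ W 0 :=
    ((AnalyticAt.fun_comp hGρ hop).mul analyticAt_const).add analyticAt_const
  let b (y : Fin n → ℝ) : X →L[ℝ] X := Ring.inverse (W y) * H (operatorPoint (ρ • S) y)
  have hb : AnalyticAt ℝ b 0 := by
    refine AnalyticAt.mul (AnalyticAt.fun_comp ?_ hWan) (AnalyticAt.fun_comp hHρ hop)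
    rw [hW0]
    exact analyticAt_inverse (𝕜 := ℝ) (1 : (X →L[ℝ] X)ˣ)
  let tail : (Fin (n + 1) → ℝ) →L[ℝ] (Fin n → ℝ) :=
    ContinuousLinearMap.pi fun i => ContinuousLinearMap.proj i.succ
  have htail : Tendsto tail (𝓝 0) (𝓝 0) := tail.continuous.tendsto' _ _ (map_zero _)
  have hdiv : AnalyticAt ℝ (fun z : Fin (n + 1) → ℝ => z 0 / ρ) 0 :=
    ((ContinuousLinearMap.proj (R := ℝ) (φ := fun _ : Fin (n + 1) => ℝ) 0).analyticAt 0).div_const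
  have hdiv0 : Tendsto (fun z : Fin (n + 1) → ℝ => z 0 / ρ) (𝓝 0) (𝓝 0) := by
    simpa using hdiv.continuousAt.tendsto
  refine ⟨fun z => IsShift.eval B φ (z 0 / ρ) (Q (b (tail z) e)),
    fun k y => ρ⁻¹ ^ (k : ℕ) * φ ((B ^ (k : ℕ)) (b y e)), ?_, fun k => ?_, ?_⟩
  · have h1 : AnalyticAt ℝ (fun z : Fin (n + 1) → ℝ => IsShift.eval B φ (z 0 / ρ)) 0 :=
      AnalyticAt.fun_comp (by simpa using IsShift.analyticAt_eval B φ) hdiv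
    have h2 : AnalyticAt ℝ (fun z => Q (b (tail z) e)) 0 := by
      have h3 : AnalyticAt ℝ (fun z => b (tail z)) 0 :=
        AnalyticAt.fun_comp (by simpa using hb) (tail.analyticAt 0)
      exact ((Q.comp (ContinuousLinearMap.apply ℝ X e)).analyticAt _).fun_comp h3
    exact ((ContinuousLinearMap.id ℝ (X →L[ℝ] ℝ)).analyticAt_bilinear _).fun_comp (h1.prod h2)
  · have h1 := ((((φ.comp (B ^ (k : ℕ))).comp (ContinuousLinearMap.apply ℝ X e)).analyticAt
      _).fun_comp hb)
    exact analyticAt_const.mul h1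
  · have hWu : ∀ᶠ y in 𝓝 0, IsUnit (W y) :=
      hWan.continuousAt.eventually (Units.isOpen.mem_nhds (by rw [hW0]; exact isUnit_one))
    filter_upwards [hρG, hρH, htail.eventually hWu, hdiv0.eventually (IsShift.eventually_isUnit B)]
      with z h1 h2 h3 ht
    change h z = g z * IsShift.eval B φ (z 0 / ρ) (Q (b (fun i => z i.succ) e)) +
      ∑ k : Fin d, ρ⁻¹ ^ (k : ℕ) * φ ((B ^ (k : ℕ)) (b (fun i => z i.succ) e)) * z 0 ^ (k : ℕ)
    change IsUnit (W fun i => z i.succ) at h3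
    have h4 : W (fun i => z i.succ) * b (fun i => z i.succ) =
        H (operatorPoint (ρ • S) fun i => z i.succ) := Ring.mul_inverse_cancel_left _ _ h3
    have h5 := h2 e
    rw [hX.eval_basis ht, mul_one, ← h4, mul_apply_eq_comp] at h5
    simp only [W, add_apply, sub_apply, mul_apply_eq_comp, one_apply_eq_self, map_add, map_sub,
      h1, hX.eval_pow_comp_forward ht] at h5
    rw [hX.eval_eq_sum_add ht d (b _ e), add_sub_cancel_right] at h5
    rw [← h5]
    congr 1
    refine Finset.sum_congr rfl fun k _ => ?_
    rw [div_eq_mul_inv, mul_pow]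
    ring

namespace analyticAtZero

variable {m n : ℕ} {K : Type*} [Field K] [Algebra ℝ K]

/-- A homomorphism from the algebra of functions analytic at the origin that only depends on
germs. -/
def IsGermHom (ev : analyticAtZero n →ₐ[ℝ] K) : Prop := ∀ f, f.1 =ᶠ[𝓝 0] 0 → ev f = 0

theorem IsGermHom.congr {ev : analyticAtZero n →ₐ[ℝ] K} (hev : IsGermHom ev)
    {f g : analyticAtZero n} (h : f.1 =ᶠ[𝓝 0] g.1) : ev f = ev g := by
  rw [← sub_eq_zero, ← map_sub]
  refine hev _ ?_
  filter_upwards [h] with x hx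
  exact sub_eq_zero.2 hx

theorem IsGermHom.comp_pullback {ev : analyticAtZero m →ₐ[ℝ] K} (hev : IsGermHom ev)
    (L : (Fin m → ℝ) →L[ℝ] (Fin n → ℝ)) : IsGermHom (ev.comp (pullback L)) := by
  intro f hf
  refine hev _ ?_
  have hL : Tendsto L (𝓝 0) (𝓝 0) := by simpa using L.continuous.tendsto 0
  exact hL.eventually hf

/-- A derivation satisfies the chain rule at `f` with respect to evaluation by `ev`. -/
def SatisfiesChainRule (ev : analyticAtZero n →ₐ[ℝ] K) (D : Derivation ℝ K K)
    (f : analyticAtZero n) : Prop :=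
  D (ev f) = ∑ i, ev (pderiv i f) * D (ev (coord i))

section ChainRule

variable {ev : analyticAtZero n →ₐ[ℝ] K} {D : Derivation ℝ K K} {f g : analyticAtZero n}

theorem SatisfiesChainRule.congr (hev : IsGermHom ev) (hfg : f.1 =ᶠ[𝓝 0] g.1)
    (hf : SatisfiesChainRule ev D f) : SatisfiesChainRule ev D g := by
  unfold SatisfiesChainRule at *
  rw [← hev.congr hfg, hf]
  exact Finset.sum_congr rfl fun i _ => by rw [hev.congr (pderiv_congr i hfg)]

theorem SatisfiesChainRule.add (hev : IsGermHom ev) (hf : SatisfiesChainRule ev D f)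
    (hg : SatisfiesChainRule ev D g) : SatisfiesChainRule ev D (f + g) := by
  unfold SatisfiesChainRule at *
  rw [map_add, map_add, hf, hg, ← Finset.sum_add_distrib]
  exact Finset.sum_congr rfl fun i _ => by rw [hev.congr (pderiv_add i f g), map_add, add_mul]

theorem sum_pderiv_mul (hev : IsGermHom ev) (D : Derivation ℝ K K) (f g : analyticAtZero n) :
    ∑ i, ev (pderiv i (f * g)) * D (ev (coord i)) =
      ev f * ∑ i, ev (pderiv i g) * D (ev (coord i)) +
        ev g * ∑ i, ev (pderiv i f) * D (ev (coord i)) := by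
  rw [Finset.mul_sum, Finset.mul_sum, ← Finset.sum_add_distrib]
  refine Finset.sum_congr rfl fun i _ => ?_
  rw [hev.congr (pderiv_mul i f g), map_add, map_mul, map_mul]
  ring

theorem SatisfiesChainRule.mul (hev : IsGermHom ev) (hf : SatisfiesChainRule ev D f)
    (hg : SatisfiesChainRule ev D g) : SatisfiesChainRule ev D (f * g) := by
  unfold SatisfiesChainRule at *
  rw [sum_pderiv_mul hev, ← hf, ← hg, map_mul, D.leibniz, smul_eq_mul, smul_eq_mul]

theorem SatisfiesChainRule.mul_of_eq_zero (hev : IsGermHom ev) (hf : SatisfiesChainRule ev D f)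
    (hf0 : ev f = 0) (g : analyticAtZero n) : SatisfiesChainRule ev D (f * g) := by
  unfold SatisfiesChainRule at *
  rw [sum_pderiv_mul hev, ← hf, map_mul, hf0]
  simp

theorem satisfiesChainRule_algebraMap (c : ℝ) :
    SatisfiesChainRule ev D (algebraMap ℝ _ c) := by
  simp [SatisfiesChainRule, pderiv_algebraMap]

theorem satisfiesChainRule_coord (i : Fin n) : SatisfiesChainRule ev D (coord i) := by
  simp [SatisfiesChainRule, pderiv_coord, Pi.single_apply]

variable (ev D) in
/-- The functions at which a derivation satisfies the chain rule. -/
def chainRuleSubalgebra (hev : IsGermHom ev) : Subalgebra ℝ (analyticAtZero n) where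
  carrier := {f | SatisfiesChainRule ev D f}
  mul_mem' := .mul hev
  add_mem' := .add hev
  algebraMap_mem' := satisfiesChainRule_algebraMap

theorem sum_pderiv_pullback {ev : analyticAtZero m →ₐ[ℝ] K} (hev : IsGermHom ev)
    (D : Derivation ℝ K K) (L : (Fin m → ℝ) →L[ℝ] (Fin n → ℝ)) (f : analyticAtZero n) :
    ∑ i, ev (pderiv i (pullback L f)) * D (ev (coord i)) =
      ∑ j, ev (pullback L (pderiv j f)) * D (ev (pullback L (coord j))) := by
  have hcoord (j : Fin n) : pullback L (coord j) =
      ∑ i, L (Pi.single i 1) j • (coord i : analyticAtZero m) := by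
    ext x
    change L x j = _
    conv_lhs => rw [pi_eq_sum_univ' x, map_sum]
    simp [coord, Finset.sum_apply, mul_comm]
  simp only [hcoord, map_sum, map_smul, Finset.mul_sum]
  rw [Finset.sum_comm]
  refine Finset.sum_congr rfl fun i _ => ?_
  rw [hev.congr (pderiv_pullback L i f), map_sum, Finset.sum_mul]
  refine Finset.sum_congr rfl fun j _ => ?_
  simp

theorem SatisfiesChainRule.comp_pullback {ev : analyticAtZero m →ₐ[ℝ] K} (hev : IsGermHom ev)
    (L : (Fin m → ℝ) →L[ℝ] (Fin n → ℝ)) (h : SatisfiesChainRule ev D (pullback L f)) :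
    SatisfiesChainRule (ev.comp (pullback L)) D f := by
  unfold SatisfiesChainRule at *
  simp only [AlgHom.comp_apply, h, sum_pderiv_pullback hev]

end ChainRule

theorem eventuallyEq_smul_of_pderiv {u v : analyticAtZero n}
    (h : ∀ i, (v * pderiv i u).1 =ᶠ[𝓝 0] (u * pderiv i v).1) (hv : ¬ v.1 =ᶠ[𝓝 0] 0) :
    ∃ c : ℝ, u.1 =ᶠ[𝓝 0] (c • v).1 := by
  obtain ⟨r, hr, hball⟩ := Metric.eventually_nhds_iff_ball.1
    ((AnalyticAt.eventually_analyticAt u.2).and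
      ((AnalyticAt.eventually_analyticAt v.2).and (eventually_all.2 h)))
  obtain ⟨b, hb, hvb⟩ : ∃ b ∈ Metric.ball (0 : Fin n → ℝ) r, v.1 b ≠ 0 := by
    by_contra! hcon
    exact hv (Metric.eventually_nhds_iff_ball.2 ⟨r, hr, hcon⟩)
  have hnear : ∀ᶠ x in 𝓝 b, x ∈ Metric.ball (0 : Fin n → ℝ) r ∧ v.1 x ≠ 0 :=
    Eventually.and (Metric.isOpen_ball.mem_nhds hb)
      ((hball b hb).2.1.continuousAt.eventually_ne hvb)
  obtain ⟨s, hs, hsball⟩ := Metric.eventually_nhds_iff_ball.1 hnear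
  have hderiv : ∀ x ∈ Metric.ball b s, HasFDerivAt (fun x => u.1 x / v.1 x)
      (0 : (Fin n → ℝ) →L[ℝ] ℝ) x := by
    intro x hx
    obtain ⟨hxr, hvx⟩ := hsball x hx
    obtain ⟨hu', hv', heq⟩ := hball x hxr
    have hinv := (hasFDerivAt_inv' (𝕜 := ℝ) hvx).comp x hv'.differentiableAt.hasFDerivAt
    refine ((hu'.differentiableAt.hasFDerivAt.mul hinv).congr_fderiv ?_).congr_of_eventuallyEq
      (.of_forall fun y => div_eq_mul_inv _ _)
    apply ContinuousLinearMap.coe_injective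
    refine (Pi.basisFun ℝ (Fin n)).ext fun i => ?_
    rw [Pi.basisFun_apply]
    have := heq i
    change v.1 x * fderiv ℝ u.1 x (Pi.single i 1) = u.1 x * fderiv ℝ v.1 x (Pi.single i 1) at this
    simp
    field_simp
    linarith
  obtain ⟨c, hc⟩ := Metric.isOpen_ball.exists_is_const_of_fderiv_eq_zero
    (convex_ball b s).isPreconnected
    (fun x hx => (hderiv x hx).differentiableAt.differentiableWithinAt)
    (fun x hx => (hderiv x hx).fderiv)
  refine ⟨c, ?_⟩
  have hEq := AnalyticOnNhd.eqOn_of_preconnected_of_eventuallyEq (f := u.1) (g := (c • v).1)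
    (U := Metric.ball (0 : Fin n → ℝ) r) (𝕜 := ℝ) (fun x hx => (hball x hx).1)
    (fun x hx => analyticAt_const.smul (hball x hx).2.1) (convex_ball 0 r).isPreconnected hb ?_
  · exact hEq.eventuallyEq_of_mem (Metric.ball_mem_nhds _ hr)
  · filter_upwards [Metric.ball_mem_nhds b hs] with x hx
    exact (div_eq_iff (hsball x hx).2).1 (hc x hx)

theorem exists_derivation_of_injective {ev : analyticAtZero n →ₐ[ℝ] K}
    (hev : IsGermHom ev) (hfrac : ∀ y, ∃ u v, y = ev u / ev v)
    (hinj : ∀ f, ev f = 0 → f.1 =ᶠ[𝓝 0] 0) (i : Fin n) :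
    ∃ D : Derivation ℝ K K, ∀ f, D (ev f) = ev (pderiv i f) := by
  have hwd (f g : analyticAtZero n) (h : ev f = ev g) : ev (pderiv i f) = ev (pderiv i g) := by
    refine hev.congr (pderiv_congr i ?_)
    filter_upwards [hinj (f - g) (by rw [map_sub, h, sub_self])] with x hx
    exact sub_eq_zero.1 hx
  choose s hs using fun y : ev.range => y.2
  have hs' (f : analyticAtZero n) (y : ev.range) (h : ev f = y) :
      ev (pderiv i (s y)) = ev (pderiv i f) := hwd _ _ ((hs y).trans h.symm)
  let d : Derivation ℝ ev.range K := Derivation.mk'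
    { toFun := fun y => ev (pderiv i (s y))
      map_add' := fun y z => by
        rw [hs' (s y + s z) _ (by rw [map_add]; exact congrArg₂ _ (hs y) (hs z)),
          hev.congr (pderiv_add _ _ _), map_add]
      map_smul' := fun c y => by
        have : (algebraMap ℝ (analyticAtZero n) c * s y) = c • s y := by rw [Algebra.smul_def]
        rw [hs' (c • s y) _ (by rw [map_smul]; exact congrArg _ (hs y)), ← this,
          hev.congr (pderiv_mul _ _ _), pderiv_algebraMap]
        simp [Algebra.smul_def] }
    (fun y z => by
      change ev (pderiv i (s (y * z))) = y.1 * ev (pderiv i (s z)) + z.1 * ev (pderiv i (s y))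
      rw [hs' (s y * s z) _ (by rw [map_mul]; exact congrArg₂ _ (hs y) (hs z)),
        hev.congr (pderiv_mul _ _ _), map_add, map_mul, map_mul]
      exact congrArg₂ _ (congrArg (· * _) (hs y)) (congrArg (· * _) (hs z)))
  have : IsFractionRing ev.range K := IsFractionRing.of_field _ _ fun y => by
    obtain ⟨u, v, rfl⟩ := hfrac y
    exact ⟨⟨ev u, u, rfl⟩, ⟨ev v, v, rfl⟩, rfl⟩
  have : Algebra.FormallyEtale ev.range K :=
    Algebra.FormallyEtale.of_isLocalization (nonZeroDivisors ev.range)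
  obtain ⟨D, hD⟩ := exists_derivation_extension d
  exact ⟨D, fun f => (hD ⟨ev f, f, rfl⟩).trans (hs' f _ rfl)⟩

theorem isAlgebraic_of_injective {ev : analyticAtZero n →ₐ[ℝ] K}
    (hev : IsGermHom ev) (hfrac : ∀ y, ∃ u v, y = ev u / ev v)
    (hinj : ∀ f, ev f = 0 → f.1 =ᶠ[𝓝 0] 0) {a : K}
    (ha : ∀ D : Derivation ℝ K K, (∀ f, SatisfiesChainRule ev D f) → D a = 0) :
    IsAlgebraic ℝ a := by
  obtain ⟨u, v, rfl⟩ := hfrac a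
  by_cases hv : ev v = 0
  · rw [hv, div_zero]
    exact isAlgebraic_zero
  suffices h : ∀ i, ev (v * pderiv i u) = ev (u * pderiv i v) by
    obtain ⟨c, hc⟩ := eventuallyEq_smul_of_pderiv (u := u) (v := v) (fun i => by
      filter_upwards [hinj (v * pderiv i u - u * pderiv i v)
        (by rw [map_sub, h, sub_self])] with x hx
      exact sub_eq_zero.1 hx) (fun h => hv (hev _ h))
    rw [hev.congr hc, map_smul, Algebra.smul_def, mul_div_cancel_right₀ _ hv]
    exact isAlgebraic_algebraMap c
  intro i
  obtain ⟨D, hD⟩ := exists_derivation_of_injective hev hfrac hinj i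
  have h0 := ha D fun f => by
    simp [SatisfiesChainRule, hD, pderiv_coord, Pi.single_apply]
  have h1 : D (ev u / ev v * ev v) = D (ev u) := by rw [div_mul_cancel₀ _ hv]
  rw [D.leibniz, h0, hD, hD, smul_zero, add_zero, smul_eq_mul] at h1
  rw [map_mul, map_mul, ← h1]
  field_simp

end analyticAtZero

namespace analyticAtZero

variable {n : ℕ}

/-- The projection of `ℝⁿ⁺¹` that drops the first coordinate. -/
def tailMap (n : ℕ) : (Fin (n + 1) → ℝ) →L[ℝ] (Fin n → ℝ) :=
  ContinuousLinearMap.pi fun i => ContinuousLinearMap.proj i.succ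

/-- A function that does not vanish identically on the first coordinate axis near the origin. -/
def IsRegular (g : analyticAtZero (n + 1)) : Prop :=
  ¬ ∀ᶠ t in 𝓝 (0 : ℝ), g.1 (Pi.single 0 t) = 0

theorem IsRegular.exists_division {g : analyticAtZero (n + 1)} (hg : IsRegular g) :
    ∃ d : ℕ, ∀ h : analyticAtZero (n + 1), ∃ (q : analyticAtZero (n + 1))
      (r : Fin d → analyticAtZero n),
        h.1 =ᶠ[𝓝 0] (g * q + ∑ k, pullback (tailMap n) (r k) * coord 0 ^ (k : ℕ)).1 := by
  obtain ⟨d, hd⟩ := exists_weierstrass_division g.2 hg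
  refine ⟨d, fun h => ?_⟩
  obtain ⟨q, r, hq, hr, heq⟩ := hd h.1 h.2
  refine ⟨⟨q, hq⟩, fun k => ⟨r k, hr k⟩, ?_⟩
  filter_upwards [heq] with z hz
  rw [hz]
  simp [Finset.sum_apply, coord, tailMap]

theorem isRegular_pow_sub_sum {d : ℕ} (r : Fin d → analyticAtZero n) :
    IsRegular (coord 0 ^ d - ∑ k : Fin d, pullback (tailMap n) (r k) * coord 0 ^ (k : ℕ)) := by
  intro h
  let P : Polynomial ℝ := Polynomial.X ^ d - ∑ k : Fin d, Polynomial.C ((r k).1 0) *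
    Polynomial.X ^ (k : ℕ)
  have hP : P.Monic := by
    refine Polynomial.monic_X_pow_sub ?_
    refine (Polynomial.degree_sum_le _ _).trans_lt ?_
    rw [Finset.sup_lt_iff (WithBot.bot_lt_coe _)]
    intro k _
    exact (Polynomial.degree_C_mul_X_pow_le _ _).trans_lt (WithBot.coe_lt_coe.2 k.2)
  have hroot : ∀ᶠ t in 𝓝 (0 : ℝ), P.IsRoot t := by
    filter_upwards [h] with t ht
    have htail : tailMap n (Pi.single 0 t) = 0 := by
      ext i
      simp [tailMap]
    simpa [Finset.sum_apply, coord, htail, P, Polynomial.eval_finsetSum] using ht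
  have hfin : {t | P.IsRoot t}.Finite := Polynomial.finite_setOfPred_isRoot hP.ne_zero
  exact Set.Infinite.mono (fun _ h => h) (infinite_of_mem_nhds (0 : ℝ) hroot) hfin

theorem exists_isRegular_pullback {g : analyticAtZero (n + 1)} (hg : ¬ g.1 =ᶠ[𝓝 0] 0) :
    ∃ M : (Fin (n + 1) → ℝ) ≃L[ℝ] (Fin (n + 1) → ℝ),
      IsRegular (pullback (M : (Fin (n + 1) → ℝ) →L[ℝ] (Fin (n + 1) → ℝ)) g) := by
  obtain ⟨ρ, hρ, hball⟩ := Metric.eventually_nhds_iff_ball.1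
    (AnalyticAt.eventually_analyticAt g.2)
  obtain ⟨w, hw, hgw⟩ : ∃ w, w ≠ 0 ∧ ¬ ∀ᶠ t in 𝓝 (0 : ℝ), g.1 (t • w) = 0 := by
    by_contra! hcon
    have key : ∀ w ∈ Metric.ball (0 : Fin (n + 1) → ℝ) ρ, w ≠ 0 → g.1 w = 0 := by
      intro w hw hw0
      have hmem : ∀ t ∈ Set.Icc (0 : ℝ) 1, t • w ∈ Metric.ball (0 : Fin (n + 1) → ℝ) ρ := by
        intro t ht
        rw [mem_ball_zero_iff] at hw ⊢
        rw [norm_smul, Real.norm_of_nonneg ht.1]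
        nlinarith [ht.2, norm_nonneg w]
      have han : AnalyticOnNhd ℝ (fun t : ℝ => g.1 (t • w)) (Set.Icc 0 1) := fun t ht =>
        AnalyticAt.fun_comp (hball _ (hmem t ht)) (analyticAt_id.smul analyticAt_const)
      have := han.eqOn_zero_of_preconnected_of_eventuallyEq_zero isPreconnected_Icc
        (Set.left_mem_Icc.2 zero_le_one) (hcon w hw0) (Set.right_mem_Icc.2 zero_le_one)
      simpa using this
    refine hg ?_
    have hd : Dense ({0}ᶜ : Set (Fin (n + 1) → ℝ)) := dense_compl_singleton 0
    filter_upwards [Metric.ball_mem_nhds (0 : Fin (n + 1) → ℝ) hρ] with w hw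
    by_contra hne
    have hev := (hball w hw).continuousAt.eventually_ne hne
    obtain ⟨z, ⟨hz1, hz2⟩, hz3⟩ := (mem_closure_iff_nhds.1 (hd w)) _
      (hev.and (Metric.isOpen_ball.mem_nhds hw))
    exact hz1 (key z hz2 hz3)
  obtain ⟨M, hM⟩ := SeparatingDual.exists_continuousLinearEquiv_apply_eq (R := ℝ)
    (x := (Pi.single 0 1 : Fin (n + 1) → ℝ)) (y := w) (by simp) hw
  refine ⟨M, fun h => hgw (h.mono fun t ht => ?_)⟩
  have : (Pi.single 0 t : Fin (n + 1) → ℝ) = t • Pi.single 0 1 := by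
    rw [← Pi.single_smul, smul_eq_mul, mul_one]
  simpa [this, hM] using ht

section Tail

universe u

variable {K : Type u} [Field K] [Algebra ℝ K] {ev : analyticAtZero (n + 1) →ₐ[ℝ] K}

variable (ev) in
/-- The subfield generated by the values of the functions of the last `n` coordinates. -/
noncomputable def tailField : IntermediateField ℝ K :=
  IntermediateField.adjoin ℝ (Set.range (ev.comp (pullback (tailMap n))))

variable (ev) in
/-- Evaluation of functions of the last `n` coordinates. -/
noncomputable def tailEval : analyticAtZero n →ₐ[ℝ] tailField ev :=
  (ev.comp (pullback (tailMap n))).codRestrict (tailField ev).toSubalgebra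
    fun f => IntermediateField.subset_adjoin ℝ _ ⟨f, rfl⟩

theorem coe_tailEval (f : analyticAtZero n) :
    algebraMap (tailField ev) K (tailEval ev f) = ev (pullback (tailMap n) f) := rfl

theorem isGermHom_tailEval (hev : IsGermHom ev) : IsGermHom (tailEval ev) := fun f hf =>
  Subtype.ext (hev.comp_pullback (tailMap n) f hf)

theorem exists_eq_tailEval_div (y : tailField ev) :
    ∃ u v, y = tailEval ev u / tailEval ev v := by
  obtain ⟨r, hr, s, hs, h⟩ := IntermediateField.mem_adjoin_iff_div.1 y.2
  rw [← AlgHom.coe_range, Algebra.adjoin_eq] at hr hs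
  obtain ⟨u, rfl⟩ := hr
  obtain ⟨v, rfl⟩ := hs
  exact ⟨u, v, Subtype.ext h⟩

theorem isAlgebraic_tailField (hev : IsGermHom ev) (hfrac : ∀ y, ∃ u v, y = ev u / ev v)
    {g : analyticAtZero (n + 1)} (hg : IsRegular g) (hg0 : ev g = 0) :
    Algebra.IsAlgebraic (tailField ev) K := by
  obtain ⟨d, hd⟩ := hg.exists_division
  have hdiv (h : analyticAtZero (n + 1)) : ∃ r : Fin d → analyticAtZero n,
      ev h = ∑ k : Fin d, algebraMap (tailField ev) K (tailEval ev (r k)) *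
        ev (coord 0) ^ (k : ℕ) := by
    obtain ⟨q, r, h⟩ := hd h
    exact ⟨r, by simp [hev.congr h, hg0]; rfl⟩
  have hx : IsIntegral (tailField ev) (ev (coord 0)) := by
    obtain ⟨r, hr⟩ := hdiv (coord 0 ^ d)
    refine ⟨Polynomial.X ^ d - ∑ k : Fin d, Polynomial.C (tailEval ev (r k)) *
      Polynomial.X ^ (k : ℕ), Polynomial.monic_X_pow_sub ?_, ?_⟩
    · refine (Polynomial.degree_sum_le _ _).trans_lt ?_
      rw [Finset.sup_lt_iff (WithBot.bot_lt_coe _)]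
      intro k _
      exact (Polynomial.degree_C_mul_X_pow_le _ _).trans_lt (WithBot.coe_lt_coe.2 k.2)
    · rw [map_pow] at hr
      simp [Polynomial.eval₂_finsetSum, hr]
  have hinteg (h : analyticAtZero (n + 1)) : IsIntegral (tailField ev) (ev h) := by
    obtain ⟨r, hr⟩ := hdiv h
    rw [hr]
    exact IsIntegral.sum _ fun k _ => isIntegral_algebraMap.mul (hx.pow _)
  refine ⟨fun y => ?_⟩
  obtain ⟨u, v, rfl⟩ := hfrac y
  rw [div_eq_mul_inv]
  exact (hinteg u).isAlgebraic.mul (hinteg v).isAlgebraic.inv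

theorem satisfiesChainRule_of_tailField (hev : IsGermHom ev)
    {g : analyticAtZero (n + 1)} (hg : IsRegular g) (hg0 : ev g = 0)
    {D' : Derivation ℝ (tailField ev) (tailField ev)}
    (hD' : ∀ f, SatisfiesChainRule (tailEval ev) D' f) {D : Derivation ℝ K K}
    (hD : ∀ s, D (algebraMap (tailField ev) K s) = algebraMap (tailField ev) K (D' s)) (f) :
    SatisfiesChainRule ev D f := by
  have htail (f : analyticAtZero n) : SatisfiesChainRule ev D (pullback (tailMap n) f) := by
    unfold SatisfiesChainRule
    rw [sum_pderiv_pullback hev]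
    simp only [← coe_tailEval, hD, ← map_mul, ← map_sum]
    rw [hD' f]
  have hrem {d : ℕ} (r : Fin d → analyticAtZero n) :
      (∑ k, pullback (tailMap n) (r k) * coord 0 ^ (k : ℕ)) ∈ chainRuleSubalgebra ev D hev :=
    sum_mem fun k _ => mul_mem (htail _) (pow_mem (satisfiesChainRule_coord 0) _)
  obtain ⟨d, hd⟩ := hg.exists_division
  obtain ⟨q, r, hqr⟩ := hd (coord 0 ^ d)
  have hp := isRegular_pow_sub_sum r
  have hpmem : coord 0 ^ d - ∑ k : Fin d, pullback (tailMap n) (r k) * coord 0 ^ (k : ℕ) ∈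
      chainRuleSubalgebra ev D hev :=
    sub_mem (pow_mem (satisfiesChainRule_coord 0) _) (hrem r)
  have hp0 :
      ev (coord 0 ^ d - ∑ k : Fin d, pullback (tailMap n) (r k) * coord 0 ^ (k : ℕ)) = 0 := by
    rw [map_sub, hev.congr hqr, map_add, map_mul, hg0, zero_mul, zero_add, sub_self]
  obtain ⟨e, he⟩ := hp.exists_division
  obtain ⟨q', r', hqr'⟩ := he f
  exact .congr hev hqr'.symm (.add hev (.mul_of_eq_zero hev hpmem hp0 q') (hrem r'))

end Tail

universe u in
theorem isAlgebraic_of_forall_derivation (n : ℕ) : ∀ {K : Type u} [Field K] [Algebra ℝ K]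
    {ev : analyticAtZero n →ₐ[ℝ] K} (_ : IsGermHom ev) (_ : ∀ y, ∃ u v, y = ev u / ev v)
    {a : K} (_ : ∀ D : Derivation ℝ K K, (∀ f, SatisfiesChainRule ev D f) → D a = 0),
    IsAlgebraic ℝ a := by
  induction n with
  | zero =>
    intro K _ _ ev hev hfrac a ha
    refine isAlgebraic_of_injective hev hfrac (fun f hf => .of_forall fun x => ?_) ha
    have hfc : f = algebraMap ℝ _ (f.1 x) := by
      ext y
      rw [Subsingleton.elim y x]
      rfl
    rw [hfc, AlgHom.commutes] at hf
    exact (map_eq_zero _).1 hf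
  | succ n ih =>
    intro K _ _ ev hev hfrac a ha
    by_cases hinj : ∀ f, ev f = 0 → f.1 =ᶠ[𝓝 0] 0
    · exact isAlgebraic_of_injective hev hfrac hinj ha
    push Not at hinj
    obtain ⟨g, hg0, hg⟩ := hinj
    obtain ⟨M, hM⟩ := exists_isRegular_pullback hg
    let L : (Fin (n + 1) → ℝ) →L[ℝ] (Fin (n + 1) → ℝ) := M
    let L' : (Fin (n + 1) → ℝ) →L[ℝ] (Fin (n + 1) → ℝ) := M.symm
    have hLL (f : analyticAtZero (n + 1)) : pullback L' (pullback L f) = f := by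
      ext x
      simp [L, L']
    have hLL' (f : analyticAtZero (n + 1)) : pullback L (pullback L' f) = f := by
      ext x
      simp [L, L']
    let evL := ev.comp (pullback L')
    have hevL : IsGermHom evL := hev.comp_pullback L'
    have hevLL : evL.comp (pullback L) = ev := by
      ext f
      simp [evL, hLL]
    have hfracL : ∀ y, ∃ u v, y = evL u / evL v := fun y => by
      obtain ⟨u, v, h⟩ := hfrac y
      exact ⟨pullback L u, pullback L v, by simp [evL, hLL, h]⟩
    have hgL : evL (pullback L g) = 0 := by simp [evL, hLL, hg0]
    have haL : ∀ D : Derivation ℝ K K, (∀ f, SatisfiesChainRule evL D f) → D a = 0 :=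
      fun D hD => ha D fun f => by
        have := (hD (pullback L f)).comp_pullback hevL L
        rwa [hevLL] at this
    have halg := isAlgebraic_tailField hevL hfracL hM hgL
    have hinteg : IsIntegral (tailField evL) a := (halg.isAlgebraic a).isIntegral
    refine isAlgebraic_of_coeff_minpoly hinteg fun k => ih (isGermHom_tailEval hevL)
      exists_eq_tailEval_div fun D' hD' => ?_
    have : Algebra.FormallyEtale (tailField evL) K := Algebra.FormallyEtale.of_isSeparable _ _
    obtain ⟨D, hD⟩ := exists_derivation_extension
      ((Algebra.linearMap (tailField evL) K).compDer D')
    exact derivation_coeff_minpoly_eq_zero D' D hD hinteg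
      (haL D (satisfiesChainRule_of_tailField hevL hM hgL hD' hD)) k

end analyticAtZero

universe u in
/-- A prime ideal is the kernel of a homomorphism to a field generated by the image. -/
theorem Ideal.IsPrime.exists_algHom_field {R : Type*} {A : Type u} [CommRing R] [CommRing A]
    [Algebra R A] {J : Ideal A} (hJ : J.IsPrime) :
    ∃ (K : Type u) (_ : Field K) (_ : Algebra R K) (ev : A →ₐ[R] K),
      (∀ a, ev a = 0 ↔ a ∈ J) ∧ ∀ y, ∃ u v, y = ev u / ev v := by
  refine ⟨FractionRing (A ⧸ J), inferInstance, inferInstance,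
    (IsScalarTower.toAlgHom R (A ⧸ J) _).comp (Ideal.Quotient.mkₐ R J), fun a => ?_, fun y => ?_⟩
  · rw [← Ideal.Quotient.eq_zero_iff_mem]
    exact map_eq_zero_iff _ (IsFractionRing.injective (A ⧸ J) (FractionRing (A ⧸ J)))
  · obtain ⟨u, v, -, rfl⟩ := IsFractionRing.div_surjective (A := A ⧸ J) y
    obtain ⟨u, rfl⟩ := Ideal.Quotient.mk_surjective u
    obtain ⟨v, rfl⟩ := Ideal.Quotient.mk_surjective v
    exact ⟨u, v, rfl⟩

namespace analyticAtZero

variable {n : ℕ}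

theorem IsGermHom.ne_zero_of_apply_zero_ne_zero {K : Type*} [Field K] [Algebra ℝ K]
    {ev : analyticAtZero n →ₐ[ℝ] K} (hev : IsGermHom ev) {f : analyticAtZero n}
    (hf : f.1 0 ≠ 0) : ev f ≠ 0 := by
  let g : analyticAtZero n := ⟨fun x => (f.1 x)⁻¹, AnalyticAt.fun_inv f.2 hf⟩
  have h : (f * g).1 =ᶠ[𝓝 0] (1 : analyticAtZero n).1 := by
    filter_upwards [(AnalyticAt.continuousAt f.2).eventually_ne hf] with x hx
    exact mul_inv_cancel₀ hx
  intro h0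
  simpa [h0] using hev.congr h

theorem IsGermHom.eq_zero_of_isAlgebraic {K : Type*} [Field K] [Algebra ℝ K]
    {ev : analyticAtZero n →ₐ[ℝ] K} (hev : IsGermHom ev) {f : analyticAtZero n}
    (hf : f.1 0 = 0) (halg : IsAlgebraic ℝ (ev f)) : ev f = 0 := by
  by_contra hne
  refine hev.ne_zero_of_apply_zero_ne_zero (f := Polynomial.aeval f (minpoly ℝ (ev f))) ?_ ?_
  · have h : (Polynomial.aeval f (minpoly ℝ (ev f))).1 0 = (minpoly ℝ (ev f)).eval (f.1 0) := by
      let φ : analyticAtZero n →ₐ[ℝ] ℝ := (Pi.evalAlgHom ℝ _ 0).comp (analyticAtZero n).val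
      change φ _ = _
      rw [← Polynomial.aeval_algHom_apply, Polynomial.coe_aeval_eq_eval]
      rfl
    rw [h, hf, ← Polynomial.coeff_zero_eq_eval_zero]
    exact minpoly.coeff_zero_ne_zero halg.isIntegral hne
  · rw [← Polynomial.aeval_algHom_apply, minpoly.aeval]

/-- The ideal of functions that vanish identically near the origin. -/
def zeroGerms (n : ℕ) : Ideal (analyticAtZero n) where
  carrier := {f | f.1 =ᶠ[𝓝 0] 0}
  add_mem' {f g} hf hg := by
    filter_upwards [hf, hg] with x hx hy
    change f.1 x + g.1 x = 0
    simp [hx, hy]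
  zero_mem' := .rfl
  smul_mem' c f hf := by
    filter_upwards [hf] with x hx
    change c.1 x * f.1 x = 0
    simp [hx]

theorem mem_radical_span_pderiv {f : analyticAtZero n} (hf : f.1 0 = 0) :
    f ∈ (Ideal.span (Set.range fun i => pderiv i f) ⊔ zeroGerms n).radical := by
  rw [Ideal.radical_eq_sInf, Ideal.mem_sInf]
  rintro J ⟨hJ, hprime⟩
  obtain ⟨K, _, _, ev, hker, hfrac⟩ := Ideal.IsPrime.exists_algHom_field (R := ℝ) hprime
  have hev : IsGermHom ev := fun g hg => (hker g).2 (hJ (Ideal.mem_sup_right hg))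
  refine (hker f).1 (hev.eq_zero_of_isAlgebraic hf
    (isAlgebraic_of_forall_derivation n hev hfrac fun D hD => ?_))
  rw [hD f]
  refine Finset.sum_eq_zero fun i _ => ?_
  rw [(hker _).2 (hJ (Ideal.mem_sup_left (Ideal.subset_span ⟨i, rfl⟩))), zero_mul]

theorem eventually_eq_zero_of_fderiv_eq_zero {f : analyticAtZero n} (hf : f.1 0 = 0) :
    ∀ᶠ x in 𝓝 0, fderiv ℝ f.1 x = 0 → f.1 x = 0 := by
  obtain ⟨m, hm⟩ := mem_radical_span_pderiv hf
  obtain ⟨s, hs, z, hz, hsz⟩ := Submodule.mem_sup.1 hm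
  obtain ⟨c, rfl⟩ := Ideal.mem_span_range_iff_exists_fun.1 hs
  filter_upwards [show z.1 =ᶠ[𝓝 0] 0 from hz] with x hx hcrit
  have h := congrArg (fun g : analyticAtZero n => g.1 x) hsz
  have hp (i : Fin n) : (pderiv i f).1 x = 0 := by
    change fderiv ℝ f.1 x _ = 0
    simp [hcrit]
  simp only [Subalgebra.coe_add, Pi.add_apply, hx, Subalgebra.coe_pow, Pi.pow_apply,
    AddSubmonoidClass.coe_finsetSum, Finset.sum_apply, Subalgebra.coe_mul, Pi.mul_apply, hp,
    mul_zero, Finset.sum_const_zero, Pi.zero_apply, add_zero] at h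
  exact eq_zero_of_pow_eq_zero h.symm

end analyticAtZero

section CriticalValues

variable {E : Type*} [NormedAddCommGroup E] [NormedSpace ℝ E] [FiniteDimensional ℝ E] {F : E → ℝ}

/-- An analytic function is locally constant on its critical set. -/
theorem AnalyticAt.eventually_eq_of_fderiv_eq_zero {x₀ : E} (hF : AnalyticAt ℝ F x₀) :
    ∀ᶠ x in 𝓝 x₀, fderiv ℝ F x = 0 → F x = F x₀ := by
  let e := (Module.finBasis ℝ E).equivFunL.symm
  let f : analyticAtZero (Module.finrank ℝ E) := ⟨fun y => F (x₀ + e y) - F x₀, by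
    refine AnalyticAt.sub (AnalyticAt.fun_comp (by simpa using hF) ?_) analyticAt_const
    exact analyticAt_const.add (e.analyticAt 0)⟩
  have h := analyticAtZero.eventually_eq_zero_of_fderiv_eq_zero (f := f) (by simp [f])
  have htend : Tendsto (fun x => e.symm (x - x₀)) (𝓝 x₀) (𝓝 0) := by
    have : Continuous fun x => e.symm (x - x₀) := by fun_prop
    simpa using this.tendsto x₀
  filter_upwards [htend.eventually h, hF.eventually_analyticAt] with x hx hFx hcrit
  have hpt : x₀ + e (e.symm (x - x₀)) = x := by simp
  have hder : HasFDerivAt f.1 (0 : (Fin (Module.finrank ℝ E) → ℝ) →L[ℝ] ℝ) (e.symm (x - x₀)) := by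
    have h1 : HasFDerivAt F (0 : E →L[ℝ] ℝ) (x₀ + e (e.symm (x - x₀))) := by
      rw [hpt, ← hcrit]
      exact hFx.differentiableAt.hasFDerivAt
    have h2 : HasFDerivAt f.1 _ _ := (HasFDerivAt.comp (f := fun y => x₀ + e y)
      (g := F) (e.symm (x - x₀)) h1
      (e.hasFDerivAt.const_add x₀)).sub_const (F x₀)
    rwa [ContinuousLinearMap.zero_comp] at h2
  have := hx hder.fderiv
  simp only [f, hpt] at this
  linarith

theorem AnalyticOnNhd.finite_criticalValues_inter_Icc (hF : AnalyticOnNhd ℝ F Set.univ)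
    (hcoerc : Tendsto F (cocompact E) atTop) (a b : ℝ) :
    (F '' {x | fderiv ℝ F x = 0} ∩ Set.Icc a b).Finite := by
  have hcont : Continuous F := continuousOn_univ.1 hF.continuousOn
  have hcont' : Continuous (fderiv ℝ F) := continuousOn_univ.1 hF.fderiv.continuousOn
  obtain ⟨C, hC, hsub⟩ := mem_cocompact.1 (hcoerc.eventually_gt_atTop b)
  let S : Set E := {x | fderiv ℝ F x = 0} ∩ F ⁻¹' Set.Icc a b
  have hS : IsCompact S := by
    refine hC.of_isClosed_subset ((isClosed_singleton.preimage hcont').inter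
      (isClosed_Icc.preimage hcont)) fun x hx => ?_
    by_contra hxC
    exact absurd hx.2.2 (not_le.2 (hsub hxC))
  choose U hU hUconst using fun x : E =>
    (hF x trivial).eventually_eq_of_fderiv_eq_zero.exists_mem
  obtain ⟨t, -, ht⟩ := hS.elim_nhds_subcover U fun x _ => hU x
  refine (t.finite_toSet.image F).subset ?_
  rintro _ ⟨⟨x, hx, rfl⟩, hab⟩
  obtain ⟨y, hy, hxy⟩ := Set.mem_iUnion₂.1 (ht ⟨hx, hab⟩)
  exact ⟨y, hy, (hUconst y x hxy hx).symm⟩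

end CriticalValues

theorem isClosed_of_finite_inter_Icc {S : Set ℝ} (hS : ∀ a b, (S ∩ Set.Icc a b).Finite) :
    IsClosed S := by
  refine isClosed_of_closure_subset fun x hx => ?_
  have hx' : x ∈ closure (S ∩ Set.Icc (x - 1) (x + 1)) := by
    rw [mem_closure_iff_nhds] at hx ⊢
    intro t ht
    obtain ⟨y, ⟨hy1, hy2⟩, hy3⟩ := hx _ (inter_mem ht
      (Icc_mem_nhds (sub_one_lt x) (lt_add_one x)))
    exact ⟨y, hy1, hy3, hy2⟩
  rw [(hS _ _).isClosed.closure_eq] at hx'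
  exact hx'.1

theorem countable_of_finite_inter_Icc {S : Set ℝ} (hS : ∀ a b, (S ∩ Set.Icc a b).Finite) :
    S.Countable := by
  refine (Set.countable_iUnion fun n : ℕ => (hS (-n) n).countable).mono fun x hx => ?_
  obtain ⟨n, hn⟩ := exists_nat_ge |x|
  exact Set.mem_iUnion.2 ⟨n, hx, abs_le.1 hn⟩

theorem thresholdSet_eq_criticalValues {ν : ℕ} {Ω ω : EuclideanSpace ℝ (Fin ν) → ℝ}
    (P : EuclideanSpace ℝ (Fin ν)) (hΩ : Differentiable ℝ Ω) (hω : Differentiable ℝ ω) :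
    thresholdSet ν Ω ω P = (fun k => Ω (P - k) + ω k) ''
      {k | fderiv ℝ (fun k => Ω (P - k) + ω k) k = 0} := by
  have hder (k : EuclideanSpace ℝ (Fin ν)) :
      fderiv ℝ (fun k => Ω (P - k) + ω k) k = -fderiv ℝ Ω (P - k) + fderiv ℝ ω k := by
    have h1 := (hΩ (P - k)).hasFDerivAt.comp k ((hasFDerivAt_id k).const_sub P)
    refine ((h1.add (hω k).hasFDerivAt).congr_fderiv ?_).fderiv
    ext v
    simp
  ext lam
  refine exists_congr fun k => ?_
  rw [Set.mem_ofPred_eq, hder, neg_add_eq_zero, and_comm, eq_comm (a := lam)]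
  simp [gradient]

/-- **Local finiteness of the threshold set (Section 3 / Proposition 5.2).** If `Ω, ω`
are real-analytic and `F_P(k) = Ω(P−k) + ω(k) → ∞` as `|k| → ∞`, then `θ(P)` is closed,
its intersection with every compact interval is finite, and in particular it is at most
countable and of Lebesgue measure zero. -/
theorem stmt_9 (ν : ℕ) (hν : 1 ≤ ν) (P : EuclideanSpace ℝ (Fin ν))
    (Ω ω : EuclideanSpace ℝ (Fin ν) → ℝ)
    (hΩ : AnalyticOnNhd ℝ Ω Set.univ) (hω : AnalyticOnNhd ℝ ω Set.univ)
    (hcoerc : Tendsto (fun k => Ω (P - k) + ω k)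
      (cocompact (EuclideanSpace ℝ (Fin ν))) atTop) :
    IsClosed (thresholdSet ν Ω ω P) ∧
    (∀ a b : ℝ, (thresholdSet ν Ω ω P ∩ Set.Icc a b).Finite) ∧
    (thresholdSet ν Ω ω P).Countable ∧
    volume (thresholdSet ν Ω ω P) = 0 := by
  have hfin : ∀ a b : ℝ, (thresholdSet ν Ω ω P ∩ Set.Icc a b).Finite := by
    rw [thresholdSet_eq_criticalValues P (fun k => (hΩ k trivial).differentiableAt)
      (fun k => (hω k trivial).differentiableAt)]
    refine AnalyticOnNhd.finite_criticalValues_inter_Icc (fun k _ => ?_) hcoerc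
    exact (AnalyticAt.fun_comp (hΩ (P - k) trivial) (analyticAt_const.sub analyticAt_id)).add
      (hω k trivial)
  have hcount := countable_of_finite_inter_Icc hfin
  exact ⟨isClosed_of_finite_inter_Icc hfin, hfin, hcount, hcount.measure_zero volume⟩
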